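/- arXiv:1212.1932 — 2 statements merged into one kernel-verified Lean document; each statement's English description precedes it below -/
import Mathlib

section
/- Let g : [0, 2] → ℝ be continuous. Then (1/(4π)) · ∫_{‖x‖≤1} ( ∫_{ℝ³} (g(‖s‖)/‖s‖) · 𝟙_{‖x−s‖≤1}(s) ds ) dx = ∫₀² g(s) 𝒫(s) ds, where 𝒫(s) = (π/12)·(16 − 12s + s³)·s and where the inner integrand g(‖s‖)/‖s‖ is extended by any value for ‖s‖ > 2 via 𝟙_{‖x−s‖≤1} vanishing there (for ‖x‖ ≤ 1 and ‖x−s‖ ≤ 1 one always has ‖s‖ ≤ 2). -/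
open MeasureTheory Metric Real Set

lemma disk_volume (c : ℝ) :
    volume {y : Fin 2 → ℝ | y 0 ^ 2 + y 1 ^ 2 ≤ c} = ENNReal.ofReal (π * c) := by
  rcases lt_or_ge c 0 with hc | hc
  · have : {y : Fin 2 → ℝ | y 0 ^ 2 + y 1 ^ 2 ≤ c} = ∅ := by
      ext y
      simp only [mem_ofPred_eq, mem_empty_iff_false, iff_false, not_le]
      nlinarith [sq_nonneg (y 0), sq_nonneg (y 1)]
    rw [this, measure_empty, ENNReal.ofReal_of_nonpos]
    nlinarith [pi_pos]
  · have h := (PiLp.volume_preserving_toLp (Fin 2)).measure_preimage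
      (s := closedBall (0 : EuclideanSpace ℝ (Fin 2)) (√c)) measurableSet_closedBall.nullMeasurableSet
    rw [EuclideanSpace.volume_closedBall_fin_two, ← ENNReal.ofReal_pow (sqrt_nonneg c), sq_sqrt hc,
      ← ENNReal.ofReal_mul hc, mul_comm] at h
    rw [← h]
    congr 1
    ext y
    simp [EuclideanSpace.norm_eq, Fin.sum_univ_two, Real.sqrt_le_sqrt_iff hc]

lemma lens_slice (r : ℝ) :
    volume {p : Fin 3 → ℝ | p 0 ^ 2 + (p 1 ^ 2 + p 2 ^ 2) ≤ 1 ∧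
      (p 0 - r) ^ 2 + (p 1 ^ 2 + p 2 ^ 2) ≤ 1} =
      ∫⁻ t : ℝ, ENNReal.ofReal (π * min (1 - t ^ 2) (1 - (t - r) ^ 2)) := by
  have hmp := volume_preserving_piFinSuccAbove (fun _ : Fin 3 => ℝ) 0
  set S : Set (ℝ × (Fin 2 → ℝ)) := {q | q.1 ^ 2 + (q.2 0 ^ 2 + q.2 1 ^ 2) ≤ 1 ∧
      (q.1 - r) ^ 2 + (q.2 0 ^ 2 + q.2 1 ^ 2) ≤ 1} with hS
  have hSm : MeasurableSet S := by
    have m1 : MeasurableSet {q : ℝ × (Fin 2 → ℝ) | q.1 ^ 2 + (q.2 0 ^ 2 + q.2 1 ^ 2) ≤ 1} :=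
      measurableSet_le (by fun_prop) (by fun_prop)
    have m2 : MeasurableSet {q : ℝ × (Fin 2 → ℝ) |
        (q.1 - r) ^ 2 + (q.2 0 ^ 2 + q.2 1 ^ 2) ≤ 1} :=
      measurableSet_le (by fun_prop) (by fun_prop)
    exact m1.inter m2
  have h := hmp.measure_preimage (s := S) hSm.nullMeasurableSet
  have h2 : volume S = ∫⁻ t : ℝ, ENNReal.ofReal (π * min (1 - t ^ 2) (1 - (t - r) ^ 2)) := by
    rw [Measure.volume_eq_prod, Measure.prod_apply hSm]
    refine lintegral_congr fun t => ?_
    rw [← disk_volume]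
    congr 1
    ext y
    simp only [hS, mem_preimage, mem_ofPred_eq, le_min_iff]
    constructor <;> rintro ⟨h1, h2⟩ <;> constructor <;> linarith
  rw [← h2, ← h]
  congr 1

lemma lens_lintegral (r : ℝ) (h0 : 0 ≤ r) (h2 : r ≤ 2) :
    ∫⁻ t : ℝ, ENNReal.ofReal (π * min (1 - t ^ 2) (1 - (t - r) ^ 2)) =
      ENNReal.ofReal (π / 12 * (16 - 12 * r + r ^ 3)) := by
  have hle : r - 1 ≤ 1 := by linarith
  have hcont : Continuous fun t : ℝ => π * min (1 - t ^ 2) (1 - (t - r) ^ 2) := by fun_prop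
  have e1 : (fun t : ℝ => ENNReal.ofReal (π * min (1 - t ^ 2) (1 - (t - r) ^ 2))) =
      (Ioc (r - 1) 1).indicator
        (fun t : ℝ => ENNReal.ofReal (π * min (1 - t ^ 2) (1 - (t - r) ^ 2))) := by
    ext t
    by_cases ht : t ∈ Ioc (r - 1) 1
    · rw [indicator_of_mem ht]
    · rw [indicator_of_notMem ht, ENNReal.ofReal_of_nonpos]
      apply mul_nonpos_of_nonneg_of_nonpos pi_pos.le
      rw [min_le_iff]
      by_cases h : t ≤ 1
      · right
        have : t ≤ r - 1 := by
          by_contra hh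
          exact ht ⟨not_le.1 hh, h⟩
        nlinarith
      · left
        nlinarith
  rw [e1, lintegral_indicator measurableSet_Ioc,
    ← ofReal_integral_eq_lintegral_ofReal
      ((hcont.integrableOn_Icc (a := r - 1) (b := 1)).mono_set Ioc_subset_Icc_self)]
  · congr 1
    rw [← intervalIntegral.integral_of_le hle,
      ← intervalIntegral.integral_add_adjacent_intervals (b := r / 2)
        (hcont.intervalIntegrable _ _) (hcont.intervalIntegrable _ _)]
    have a1 : ∫ t in (r - 1)..(r / 2), π * min (1 - t ^ 2) (1 - (t - r) ^ 2) =
        ∫ t in (r - 1)..(r / 2), π * (1 - (t - r) ^ 2) := by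
      apply intervalIntegral.integral_congr
      intro t ht
      rw [uIcc_of_le (by linarith)] at ht
      have : 1 - (t - r) ^ 2 ≤ 1 - t ^ 2 := by nlinarith [ht.1, ht.2]
      simp only [min_eq_right this]
    have a2 : ∫ t in (r / 2)..1, π * min (1 - t ^ 2) (1 - (t - r) ^ 2) =
        ∫ t in (r / 2)..1, π * (1 - t ^ 2) := by
      apply intervalIntegral.integral_congr
      intro t ht
      rw [uIcc_of_le (by linarith)] at ht
      have : 1 - t ^ 2 ≤ 1 - (t - r) ^ 2 := by nlinarith [ht.1, ht.2]
      simp only [min_eq_left this]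
    have b : ∀ a b : ℝ, ∫ t in a..b, π * (1 - t ^ 2) = π * ((b - a) - (b ^ 3 - a ^ 3) / 3) := by
      intro a b
      rw [intervalIntegral.integral_const_mul, intervalIntegral.integral_sub (by simp)
        ((continuous_pow 2).intervalIntegrable _ _)]
      simp
      norm_num
    rw [a1, a2, intervalIntegral.integral_comp_sub_right (fun t => π * (1 - t ^ 2)) r, b, b]
    ring
  · refine (ae_restrict_iff' measurableSet_Ioc).2 (.of_forall fun t ht => ?_)
    simp only [Pi.zero_apply]
    apply mul_nonneg pi_pos.le
    rw [le_min_iff]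
    constructor <;> nlinarith [ht.1, ht.2]


lemma lens_axis (r : ℝ) (h0 : 0 ≤ r) (h2 : r ≤ 2) :
    volume (closedBall (0 : (EuclideanSpace ℝ (Fin 3))) 1 ∩ closedBall (EuclideanSpace.single 0 r : (EuclideanSpace ℝ (Fin 3))) 1) =
      ENNReal.ofReal (π / 12 * (16 - 12 * r + r ^ 3)) := by
  rw [← lens_lintegral r h0 h2, ← lens_slice,
    ← (PiLp.volume_preserving_toLp (Fin 3)).measure_preimage
      (measurableSet_closedBall.inter measurableSet_closedBall).nullMeasurableSet]
  congr 1
  ext p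
  simp [EuclideanSpace.norm_eq, EuclideanSpace.dist_eq, Fin.sum_univ_three, Real.dist_eq, sq_abs,
    add_assoc]

lemma lens_volume (s : (EuclideanSpace ℝ (Fin 3))) (h2 : ‖s‖ ≤ 2) :
    volume (closedBall (0 : (EuclideanSpace ℝ (Fin 3))) 1 ∩ closedBall s 1) =
      ENNReal.ofReal (π / 12 * (16 - 12 * ‖s‖ + ‖s‖ ^ 3)) := by
  rw [← lens_axis ‖s‖ (norm_nonneg s) h2]
  have hn : ‖s‖ = ‖(EuclideanSpace.single 0 ‖s‖ : (EuclideanSpace ℝ (Fin 3)))‖ := by simp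
  set w : (EuclideanSpace ℝ (Fin 3)) := EuclideanSpace.single 0 ‖s‖ with hw
  have hR := Submodule.reflection_sub hn
  set R := Submodule.reflection (Submodule.span ℝ {s - w})ᗮ
  rw [← R.measurePreserving.measure_preimage
      (s := closedBall (0 : (EuclideanSpace ℝ (Fin 3))) 1 ∩ closedBall w 1) (measurableSet_closedBall.inter measurableSet_closedBall).nullMeasurableSet]
  congr 1
  ext x
  simp only [mem_inter_iff, mem_preimage, mem_closedBall]
  rw [← hR, R.dist_map, dist_zero_right, dist_zero_right, R.norm_map]

theorem ball_average_retarded_kernel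
    (g : ℝ → ℝ) (hg : ContinuousOn g (Icc (0:ℝ) 2)) :
    (1 / (4 * π)) *
      ∫ x in closedBall (0 : EuclideanSpace ℝ (Fin 3)) 1,
        ∫ s : EuclideanSpace ℝ (Fin 3),
          (g ‖s‖ / ‖s‖) * indicator (closedBall x 1) (fun _ => (1:ℝ)) s =
    ∫ s in (0:ℝ)..2, g s * (π / 12 * (16 - 12 * s + s ^ 3) * s) := by
  set G : ℝ → ℝ := (Icc (0:ℝ) 2).indicator g with hG
  set B := closedBall (0 : (EuclideanSpace ℝ (Fin 3))) 1 with hB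
  -- integrability of the radial profile
  have hGint : Integrable (fun s : (EuclideanSpace ℝ (Fin 3)) => G ‖s‖ / ‖s‖) := by
    rw [integrable_fun_norm_addHaar volume (f := fun t => G t / t)]
    have h1 : IntegrableOn (fun t => t * g t) (Icc 0 2) :=
      (continuousOn_id.mul hg).integrableOn_Icc
    have h3 := ((integrable_indicator_iff measurableSet_Icc).2 h1).integrableOn (s := Ioi 0)
    refine h3.congr_fun (fun t ht => ?_) measurableSet_Ioi
    have ht0 : t ≠ 0 := ne_of_gt ht
    simp only [finrank_euclideanSpace_fin, smul_eq_mul, hG]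
    by_cases h : t ∈ Icc (0:ℝ) 2
    · simp only [indicator_of_mem h]
      field_simp
      norm_num
      ring
    · simp only [indicator_of_notMem h]
      simp
  -- replace g by G
  have e1 : ∫ x in B, ∫ s : (EuclideanSpace ℝ (Fin 3)), (g ‖s‖ / ‖s‖) * indicator (closedBall x 1) (fun _ => (1:ℝ)) s =
      ∫ x in B, ∫ s : (EuclideanSpace ℝ (Fin 3)), (G ‖s‖ / ‖s‖) * indicator (closedBall x 1) (fun _ => (1:ℝ)) s := by
    refine setIntegral_congr_fun measurableSet_closedBall fun x hx => ?_
    refine integral_congr_ae (.of_forall fun s => ?_)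
    by_cases hs : s ∈ closedBall x 1
    · have : ‖s‖ ∈ Icc (0:ℝ) 2 := by
        refine ⟨norm_nonneg _, ?_⟩
        rw [hB, mem_closedBall, dist_zero_right] at hx
        rw [mem_closedBall, dist_eq_norm] at hs
        have := norm_add_le (s - x) x
        rw [sub_add_cancel] at this
        linarith
      simp only [hG, indicator_of_mem this]
    · simp only [indicator_of_notMem hs, mul_zero]
  have hint : Integrable (Function.uncurry fun (x s : (EuclideanSpace ℝ (Fin 3))) =>
      (G ‖s‖ / ‖s‖) * indicator (closedBall x 1) (fun _ => (1:ℝ)) s)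
      ((volume.restrict B).prod volume) := by
    have hfin : IsFiniteMeasure (volume.restrict B) :=
      ⟨by rw [Measure.restrict_apply_univ]; exact measure_closedBall_lt_top⟩
    have hp := (Integrable.mul_prod (μ := volume.restrict B) (integrable_const (1:ℝ)) hGint)
    have hm : MeasurableSet {p : (EuclideanSpace ℝ (Fin 3)) × (EuclideanSpace ℝ (Fin 3)) | dist p.2 p.1 ≤ 1} :=
      measurableSet_le (by fun_prop) (by fun_prop)
    refine (hp.indicator hm).congr (.of_forall fun p => ?_)
    by_cases hd : dist p.2 p.1 ≤ 1
    · simp [Function.uncurry, indicator, hd]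
    · simp [Function.uncurry, indicator, hd]
  have e2 : ∀ s : (EuclideanSpace ℝ (Fin 3)), ∫ x in B, (G ‖s‖ / ‖s‖) * indicator (closedBall x 1) (fun _ => (1:ℝ)) s =
      (fun t => G t / t * (π / 12 * (16 - 12 * t + t ^ 3))) ‖s‖ := by
    intro s
    rw [integral_const_mul]
    by_cases h : ‖s‖ ≤ 2
    · simp only
      congr 1
      have : (fun x : (EuclideanSpace ℝ (Fin 3)) => indicator (closedBall x 1) (fun _ => (1:ℝ)) s) =
          indicator (closedBall s 1) (fun _ => (1:ℝ)) := by
        ext x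
        simp [indicator, dist_comm]
      rw [this, setIntegral_indicator measurableSet_closedBall, setIntegral_const, smul_eq_mul,
        mul_one, measureReal_def, hB, lens_volume s h, ENNReal.toReal_ofReal]
      have : 16 - 12 * ‖s‖ + ‖s‖ ^ 3 = (4 + ‖s‖) * (2 - ‖s‖) ^ 2 := by ring
      rw [this]
      positivity
    · have : ‖s‖ ∉ Icc (0:ℝ) 2 := fun hh => h hh.2
      simp [hG, this, -mem_Icc]
  rw [e1, integral_integral_swap hint, integral_congr_ae (.of_forall e2),
    integral_fun_norm_addHaar volume (fun t => G t / t * (π / 12 * (16 - 12 * t + t ^ 3))),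
    intervalIntegral.integral_of_le (by norm_num), measureReal_def,
    EuclideanSpace.volume_ball_fin_three]
  have e3 : ∫ y in Ioi (0:ℝ), y ^ (Module.finrank ℝ (EuclideanSpace ℝ (Fin 3)) - 1) •
        (G y / y * (π / 12 * (16 - 12 * y + y ^ 3))) =
      ∫ s in Ioc (0:ℝ) 2, g s * (π / 12 * (16 - 12 * s + s ^ 3) * s) := by
    have hI : Ioc (0:ℝ) 2 = Ioi 0 ∩ Iic 2 := rfl
    rw [hI, ← setIntegral_indicator measurableSet_Iic]
    refine setIntegral_congr_fun measurableSet_Ioi fun t ht => ?_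
    have ht0 : t ≠ 0 := ne_of_gt ht
    simp only [finrank_euclideanSpace_fin, smul_eq_mul, hG]
    by_cases h : t ≤ 2
    · rw [indicator_of_mem (show t ∈ Icc (0:ℝ) 2 from ⟨le_of_lt ht, h⟩),
        indicator_of_mem (show t ∈ Iic (2:ℝ) from h)]
      field_simp
      rw [show 3 - 1 = 2 from rfl]
      ring
    · rw [indicator_of_notMem (show t ∉ Icc (0:ℝ) 2 from fun hh => h hh.2),
        indicator_of_notMem (show t ∉ Iic (2:ℝ) from h)]
      simp
  rw [e3, finrank_euclideanSpace_fin]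
  simp only [ENNReal.ofReal_one, one_pow, one_mul, nsmul_eq_mul, smul_eq_mul]
  rw [ENNReal.toReal_ofReal (by positivity)]
  have := pi_ne_zero
  push_cast
  field_simp
end

section
/- Let f : ℝ → ℝ be C² with f, f′, f″ bounded. Define v : ℝ³ × ℝ → ℝ by v(x, t) = (1/(4π)) · ∫_{‖y‖≤1} f(t − ‖x − y‖)/‖x − y‖ dy. Then for every t ∈ ℝ and every x ∈ ℝ³ with ‖x‖ ≠ 1, the function v is twice differentiable in t and twice differentiable in x at (x, t), and it satisfies the inhomogeneous wave equation ∂²v/∂t²(x, t) − Δₓv(x, t) = f(t) · 𝟙_{‖x‖<1}(x), where Δₓ denotes the spatial Laplacian (the sum of the second partial derivatives with respect to the three coordinates of x). -/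
open MeasureTheory Metric Real Set

lemma aux_cyl (G : ℝ → ℝ → ℝ)
    (hG : Integrable fun y : EuclideanSpace ℝ (Fin 3) => G (y 0) (y 1 ^ 2 + y 2 ^ 2)) :
    ∫ y : EuclideanSpace ℝ (Fin 3), G (y 0) (y 1 ^ 2 + y 2 ^ 2) =
      2 * π * ∫ z, ∫ ρ in Ioi (0:ℝ), ρ * G z (ρ ^ 2) := by
  let e3 : ℝ × (ℝ × ℝ) ≃ᵐ ℝ × (Fin 2 → ℝ) :=
    (MeasurableEquiv.refl ℝ).prodCongr (MeasurableEquiv.finTwoArrow (α := ℝ)).symm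
  have h3 : MeasurePreserving e3 volume volume :=
    (MeasurePreserving.id volume).prod ((volume_preserving_finTwoArrow ℝ).symm _)
  let e2 : ℝ × (Fin 2 → ℝ) ≃ᵐ (Fin 3 → ℝ) :=
    (MeasurableEquiv.piFinSuccAbove (fun _ : Fin 3 => ℝ) 0).symm
  have h2 : MeasurePreserving e2 volume volume :=
    (volume_preserving_piFinSuccAbove (fun _ : Fin 3 => ℝ) 0).symm _
  let e1 := MeasurableEquiv.toLp 2 (Fin 3 → ℝ)
  have h1 : MeasurePreserving e1 volume volume := PiLp.volume_preserving_toLp (Fin 3)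
  let e := (e3.trans e2).trans e1
  have he : MeasurePreserving e volume volume := h1.comp (h2.comp h3)
  have hval : ∀ q : ℝ × (ℝ × ℝ), G ((e q) 0) ((e q) 1 ^ 2 + (e q) 2 ^ 2) =
      G q.1 (q.2.1 ^ 2 + q.2.2 ^ 2) := by
    intro q
    rfl
  have hint : Integrable (fun q : ℝ × (ℝ × ℝ) => G q.1 (q.2.1 ^ 2 + q.2.2 ^ 2)) := by
    have := (he.integrable_comp_emb e.measurableEmbedding).2 hG
    exact this.congr (Filter.Eventually.of_forall hval)
  rw [← he.integral_comp e.measurableEmbedding]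
  simp_rw [hval]
  rw [Measure.volume_eq_prod] at hint ⊢
  rw [integral_prod _ hint, ← integral_const_mul]
  congr 1
  ext z
  simp only
  rw [← integral_comp_polarCoord_symm]
  have : ∀ p : ℝ × ℝ, p.1 • G z ((polarCoord.symm p).1 ^ 2 + (polarCoord.symm p).2 ^ 2) =
      (p.1 * G z (p.1 ^ 2)) * 1 := by
    intro p
    have : (polarCoord.symm p).1 ^ 2 + (polarCoord.symm p).2 ^ 2 = p.1 ^ 2 := by
      simp only [polarCoord_symm_apply]
      nlinarith [sin_sq_add_cos_sq p.2]
    rw [this]; simp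
  simp_rw [this]
  have ht : polarCoord.target = Ioi (0:ℝ) ×ˢ Ioo (-π) π := rfl
  rw [ht, Measure.volume_eq_prod, setIntegral_prod_mul (fun ρ => ρ * G z (ρ^2)) (fun _ => (1:ℝ))]
  simp [pi_pos.le]
  ring

lemma aux_ball (g : ℝ → ℝ) (x : EuclideanSpace ℝ (Fin 3))
    (hg : IntegrableOn (fun y => g ‖x - y‖) (closedBall (0 : EuclideanSpace ℝ (Fin 3)) 1)) :
    ∫ y in closedBall (0 : EuclideanSpace ℝ (Fin 3)) 1, g ‖x - y‖ =
      2 * π * ∫ z in (-1:ℝ)..1, ∫ ρ in (0:ℝ)..√(1 - z ^ 2),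
        ρ * g (√((z - ‖x‖) ^ 2 + ρ ^ 2)) := by
  set r := ‖x‖ with hr
  let e0 : EuclideanSpace ℝ (Fin 3) := EuclideanSpace.single 0 r
  have hn : ‖e0‖ = ‖x‖ := by simp [e0, hr]
  let T : EuclideanSpace ℝ (Fin 3) ≃ₗᵢ[ℝ] EuclideanSpace ℝ (Fin 3) :=
    Submodule.reflection (Submodule.span ℝ {e0 - x})ᗮ
  have hT : T e0 = x := Submodule.reflection_sub hn
  have hTm : MeasurePreserving T volume volume := T.measurePreserving
  have hTe : MeasurableEmbedding T := T.toHomeomorph.measurableEmbedding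
  let G : ℝ → ℝ → ℝ := fun z w => if z ^ 2 + w ≤ 1 then g (√((z - r) ^ 2 + w)) else 0
  have hGy : ∀ y, (closedBall (0 : EuclideanSpace ℝ (Fin 3)) 1).indicator
      (fun y => g ‖x - y‖) (T y) = G (y 0) (y 1 ^ 2 + y 2 ^ 2) := by
    intro y
    have h1 : ‖T y‖ ≤ 1 ↔ y 0 ^ 2 + (y 1 ^ 2 + y 2 ^ 2) ≤ 1 := by
      rw [T.norm_map, EuclideanSpace.norm_eq, Real.sqrt_le_iff, Fin.sum_univ_three]
      simp [add_assoc]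
    have h2 : ‖x - T y‖ = √((y 0 - r) ^ 2 + (y 1 ^ 2 + y 2 ^ 2)) := by
      rw [← hT, ← map_sub, T.norm_map, EuclideanSpace.norm_eq, Fin.sum_univ_three]
      simp [e0]
      congr 1; ring
    simp only [indicator, mem_closedBall_zero_iff, h1, h2, G]
  rw [← integral_indicator measurableSet_closedBall, ← hTm.integral_comp hTe]
  rw [← integrable_indicator_iff measurableSet_closedBall,
    ← hTm.integrable_comp_emb hTe] at hg
  replace hg : Integrable fun y : EuclideanSpace ℝ (Fin 3) => G (y 0) (y 1 ^ 2 + y 2 ^ 2) :=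
    hg.congr (Filter.Eventually.of_forall hGy)
  simp_rw [hGy]
  rw [aux_cyl G hg]
  congr 1
  rw [intervalIntegral.integral_of_le (by norm_num), ← integral_indicator measurableSet_Ioc]
  apply integral_congr_ae
  have : ∀ᵐ z : ℝ, z ≠ -1 := by simp [ae_iff]
  filter_upwards [this] with z hz
  by_cases hz1 : z ∈ Ioc (-1:ℝ) 1
  · rw [indicator_of_mem hz1, intervalIntegral.integral_of_le (sqrt_nonneg _),
      ← integral_indicator measurableSet_Ioi, ← integral_indicator measurableSet_Ioc]
    congr 1
    ext ρ
    simp only [indicator, mem_Ioi, mem_Ioc, G]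
    by_cases hρ : 0 < ρ
    · have : ρ ≤ √(1 - z ^ 2) ↔ z ^ 2 + ρ ^ 2 ≤ 1 := by
        rw [le_sqrt' hρ]; constructor <;> intro h <;> linarith
      simp [hρ, this]
    · simp [hρ]
  · rw [indicator_of_notMem hz1]
    have : ∀ ρ, G z (ρ ^ 2) = 0 := by
      intro ρ
      simp only [G]
      rw [if_neg]
      intro h
      apply hz1
      have h3 : z ^ 2 ≤ 1 := by nlinarith
      have := abs_le.1 (abs_le_one_iff_mul_self_le_one.2 (by nlinarith : z * z ≤ 1))
      exact ⟨lt_of_le_of_ne this.1 (Ne.symm hz), this.2⟩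
    simp [this]

lemma aux_int (f : ℝ → ℝ) (hf : Continuous f) (M : ℝ) (hM : ∀ t, |f t| ≤ M) (t : ℝ)
    (x : EuclideanSpace ℝ (Fin 3)) :
    IntegrableOn (fun y => f (t - ‖x - y‖) / ‖x - y‖)
      (closedBall (0 : EuclideanSpace ℝ (Fin 3)) 1) := by
  let h : ℝ → ℝ := (Ioc (0:ℝ) (‖x‖ + 1)).indicator (fun s => M / s)
  have h0 : Integrable (fun y : EuclideanSpace ℝ (Fin 3) => h ‖y‖) := by
    rw [integrable_fun_norm_addHaar]
    have : (fun y : ℝ => y ^ (Module.finrank ℝ (EuclideanSpace ℝ (Fin 3)) - 1) • h y) =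
        (Ioc (0:ℝ) (‖x‖ + 1)).indicator (fun s => M * s) := by
      ext s
      by_cases hs : s ∈ Ioc (0:ℝ) (‖x‖ + 1)
      · have := hs.1.ne'
        simp [h, hs]
        field_simp
      · simp [h, hs]
    rw [this]
    apply Integrable.integrableOn
    rw [integrable_indicator_iff measurableSet_Ioc]
    exact (Continuous.integrableOn_Icc (by fun_prop)).mono_set Ioc_subset_Icc_self
  have h1 : Integrable (fun y : EuclideanSpace ℝ (Fin 3) => h ‖x - y‖) := h0.comp_sub_left x
  refine Integrable.mono' h1.integrableOn ?_ ?_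
  · apply Measurable.aestronglyMeasurable
    have := hf.measurable
    fun_prop
  · rw [ae_restrict_iff' measurableSet_closedBall]
    refine Filter.Eventually.of_forall fun y hy => ?_
    rw [mem_closedBall_zero_iff] at hy
    by_cases hxy : ‖x - y‖ = 0
    · simp [hxy, h]
    · have hp : 0 < ‖x - y‖ := lt_of_le_of_ne (norm_nonneg _) (Ne.symm hxy)
      have : ‖x - y‖ ∈ Ioc (0:ℝ) (‖x‖ + 1) := ⟨hp, by linarith [norm_sub_le x y]⟩
      simp only [h, indicator_of_mem this]
      rw [norm_div, norm_norm, Real.norm_eq_abs]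
      gcongr
      exact hM _

section closed
variable {f F1 F2 F3 : ℝ → ℝ}

lemma aux_shift {g g' : ℝ → ℝ} (h : ∀ s, HasDerivAt g (g' s) s) (t s : ℝ) :
    HasDerivAt (fun s => g (t - s)) (- g' (t - s)) s := by
  have := (h (t - s)).comp s ((hasDerivAt_id s).const_sub t)
  refine this.congr_deriv ?_
  simp

lemma aux_inner (hf : Continuous f) (hF1 : ∀ s, HasDerivAt F1 (f s) s) (t r z : ℝ)
    (hz : z ∈ Icc (-1:ℝ) 1) (hzr : z ≠ r) :
    ∫ ρ in (0:ℝ)..√(1 - z ^ 2), ρ * (f (t - √((z - r) ^ 2 + ρ ^ 2)) / √((z - r) ^ 2 + ρ ^ 2)) =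
      F1 (t - |z - r|) - F1 (t - √(1 + r ^ 2 - 2 * r * z)) := by
  have hp : ∀ ρ : ℝ, 0 < (z - r) ^ 2 + ρ ^ 2 := fun ρ => by
    have := sq_pos_of_ne_zero (sub_ne_zero.2 hzr)
    positivity
  have hd : ∀ ρ : ℝ, HasDerivAt (fun ρ => - F1 (t - √((z - r) ^ 2 + ρ ^ 2)))
      (ρ * (f (t - √((z - r) ^ 2 + ρ ^ 2)) / √((z - r) ^ 2 + ρ ^ 2))) ρ := by
    intro ρ
    have h1 : HasDerivAt (fun ρ => (z - r) ^ 2 + ρ ^ 2) (2 * ρ) ρ := by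
      simpa using (hasDerivAt_pow 2 ρ).const_add ((z - r) ^ 2)
    have h2 := h1.sqrt (hp ρ).ne'
    have h3 := ((aux_shift hF1 t _).comp ρ h2).neg
    refine h3.congr_deriv ?_
    have := (sqrt_pos.2 (hp ρ)).ne'
    field_simp
  rw [intervalIntegral.integral_eq_sub_of_hasDerivAt (fun ρ _ => hd ρ)]
  · have h1 : √(1 - z ^ 2) ^ 2 = 1 - z ^ 2 := sq_sqrt (by nlinarith [hz.1, hz.2])
    rw [h1]
    have h2 : (z - r) ^ 2 + (1 - z ^ 2) = 1 + r ^ 2 - 2 * r * z := by ring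
    rw [h2]
    simp [sqrt_sq_eq_abs]
    ring
  · apply Continuous.intervalIntegrable
    have : ∀ ρ : ℝ, √((z - r) ^ 2 + ρ ^ 2) ≠ 0 := fun ρ => (sqrt_pos.2 (hp ρ)).ne'
    fun_prop (disch := assumption)

lemma aux_v (hf : Continuous f) (hF1 : ∀ s, HasDerivAt F1 (f s) s) (M : ℝ)
    (hM : ∀ t, |f t| ≤ M) (t : ℝ) (x : EuclideanSpace ℝ (Fin 3)) :
    (1 / (4 * π)) *
        ∫ y in closedBall (0 : EuclideanSpace ℝ (Fin 3)) 1, f (t - ‖x - y‖) / ‖x - y‖ =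
      (1 / 2) * ((∫ z in (-1:ℝ)..1, F1 (t - |z - ‖x‖|)) -
        ∫ z in (-1:ℝ)..1, F1 (t - √(1 + ‖x‖ ^ 2 - 2 * ‖x‖ * z))) := by
  have hc : Continuous F1 := continuous_iff_continuousAt.2 fun s => (hF1 s).continuousAt
  rw [aux_ball (fun s => f (t - s) / s) x (aux_int f hf M hM t x)]
  rw [← intervalIntegral.integral_sub
    (Continuous.intervalIntegrable (by fun_prop) _ _)
    (Continuous.intervalIntegrable (by fun_prop) _ _)]
  rw [intervalIntegral.integral_congr_ae (g := fun z => F1 (t - |z - ‖x‖|) -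
    F1 (t - √(1 + ‖x‖ ^ 2 - 2 * ‖x‖ * z)))]
  · have := pi_ne_zero
    generalize (∫ z in (-1:ℝ)..1, (F1 (t - |z - ‖x‖|) -
      F1 (t - √(1 + ‖x‖ ^ 2 - 2 * ‖x‖ * z)))) = I
    field_simp
    ring
  · have : ∀ᵐ z : ℝ, z ≠ ‖x‖ := by simp [ae_iff]
    filter_upwards [this] with z hz hz1
    rw [uIoc_of_le (by norm_num)] at hz1
    exact aux_inner hf hF1 t _ z (Ioc_subset_Icc_self hz1) hz

/-- the integral of the outer sphere term -/
lemma aux_outer (hc : Continuous F1) (hF2 : ∀ s, HasDerivAt F2 (F1 s) s)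
    (hF3 : ∀ s, HasDerivAt F3 (F2 s) s) (t r : ℝ) (hr : 0 < r) (hr1 : r ≠ 1) :
    ∫ z in (-1:ℝ)..1, F1 (t - √(1 + r ^ 2 - 2 * r * z)) =
      (|1 - r| * F2 (t - |1 - r|) + F3 (t - |1 - r|)
        - ((1 + r) * F2 (t - (1 + r)) + F3 (t - (1 + r)))) / r := by
  have hp : ∀ z ∈ Icc (-1:ℝ) 1, 0 < 1 + r ^ 2 - 2 * r * z := fun z hz => by
    have := sq_pos_of_ne_zero (sub_ne_zero.2 hr1)
    nlinarith [hz.2]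
  let R : ℝ → ℝ := fun s => s * F2 (t - s) + F3 (t - s)
  have hR : ∀ s, HasDerivAt R (- (s * F1 (t - s))) s := by
    intro s
    have := ((hasDerivAt_id s).mul (aux_shift hF2 t s)).add (aux_shift hF3 t s)
    refine this.congr_deriv ?_
    simp
  have hd : ∀ z ∈ Icc (-1:ℝ) 1, HasDerivAt (fun z => R (√(1 + r ^ 2 - 2 * r * z)) / r)
      (F1 (t - √(1 + r ^ 2 - 2 * r * z))) z := by
    intro z hz
    have h1 : HasDerivAt (fun z => 1 + r ^ 2 - 2 * r * z) (- (2 * r)) z := by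
      simpa using ((hasDerivAt_id z).const_mul (2 * r)).const_sub (1 + r ^ 2)
    have h2 := h1.sqrt (hp z hz).ne'
    have h3 := ((hR _).comp z h2).div_const r
    refine h3.congr_deriv ?_
    have := (sqrt_pos.2 (hp z hz)).ne'
    generalize √(1 + r ^ 2 - 2 * r * z) = q at this
    field_simp
  rw [intervalIntegral.integral_eq_sub_of_hasDerivAt (fun z hz => hd z (by
    rwa [uIcc_of_le (by norm_num)] at hz))]
  · have h1 : √(1 + r ^ 2 - 2 * r * 1) = |1 - r| := by
      rw [← sqrt_sq_eq_abs]; congr 1; ring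
    have h2 : √(1 + r ^ 2 - 2 * r * (-1)) = 1 + r := by
      rw [← sqrt_sq (by positivity : 0 ≤ 1 + r)]; congr 1; ring
    rw [h1, h2]
    simp only [R]
    ring
  · exact Continuous.intervalIntegrable (by fun_prop) _ _

lemma aux_dist_out (hc : Continuous F1) (hF2 : ∀ s, HasDerivAt F2 (F1 s) s) (t r : ℝ)
    (hr1 : 1 < r) :
    ∫ z in (-1:ℝ)..1, F1 (t - |z - r|) = F2 (t - r + 1) - F2 (t - r - 1) := by
  rw [intervalIntegral.integral_congr (g := fun z => F1 ((t - r) + z))]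
  · rw [intervalIntegral.integral_comp_add_left,
      intervalIntegral.integral_eq_sub_of_hasDerivAt (fun s _ => hF2 s)
      (hc.intervalIntegrable _ _)]
    ring_nf
  · intro z hz
    rw [uIcc_of_le (by norm_num)] at hz
    simp only
    rw [abs_of_nonpos (by linarith [hz.2])]
    congr 1; ring

lemma aux_dist_in (hc : Continuous F1) (hF2 : ∀ s, HasDerivAt F2 (F1 s) s) (t r : ℝ)
    (hr0 : 0 ≤ r) (hr1 : r < 1) :
    ∫ z in (-1:ℝ)..1, F1 (t - |z - r|) =
      2 * F2 t - F2 (t - r - 1) - F2 (t + r - 1) := by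
  have hi : ∀ a b, IntervalIntegrable (fun z => F1 (t - |z - r|)) volume a b :=
    fun a b => Continuous.intervalIntegrable (by fun_prop) _ _
  rw [← intervalIntegral.integral_add_adjacent_intervals (hi (-1) r) (hi r 1)]
  rw [intervalIntegral.integral_congr (a := -1) (b := r) (g := fun z => F1 ((t - r) + z)),
    intervalIntegral.integral_congr (a := r) (b := 1) (g := fun z => F1 ((t + r) - z))]
  · rw [intervalIntegral.integral_comp_add_left, intervalIntegral.integral_comp_sub_left,
      intervalIntegral.integral_eq_sub_of_hasDerivAt (fun s _ => hF2 s)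
      (hc.intervalIntegrable _ _),
      intervalIntegral.integral_eq_sub_of_hasDerivAt (fun s _ => hF2 s)
      (hc.intervalIntegrable _ _)]
    ring_nf
  · intro z hz
    rw [uIcc_of_le (by linarith)] at hz
    simp only
    rw [abs_of_nonneg (by linarith [hz.1])]
    congr 1; ring
  · intro z hz
    rw [uIcc_of_le (by linarith)] at hz
    simp only
    rw [abs_of_nonpos (by linarith [hz.2])]
    congr 1; ring

/-- closed form outside -/
lemma aux_v_out (hf : Continuous f) (hF1 : ∀ s, HasDerivAt F1 (f s) s)
    (hF2 : ∀ s, HasDerivAt F2 (F1 s) s) (hF3 : ∀ s, HasDerivAt F3 (F2 s) s) (M : ℝ)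
    (hM : ∀ t, |f t| ≤ M) (t : ℝ) (x : EuclideanSpace ℝ (Fin 3)) (hx : 1 < ‖x‖) :
    (1 / (4 * π)) *
        ∫ y in closedBall (0 : EuclideanSpace ℝ (Fin 3)) 1, f (t - ‖x - y‖) / ‖x - y‖ =
      (1 / 2) * ((F2 (t - ‖x‖ - 1) + F3 (t - ‖x‖ - 1) + F2 (t - ‖x‖ + 1) - F3 (t - ‖x‖ + 1))
        / ‖x‖) := by
  have hc : Continuous F1 := continuous_iff_continuousAt.2 fun s => (hF1 s).continuousAt
  rw [aux_v hf hF1 M hM, aux_dist_out hc hF2 t _ hx,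
    aux_outer hc hF2 hF3 t _ (by linarith) hx.ne', abs_of_nonpos (by linarith)]
  have : ‖x‖ ≠ 0 := by linarith
  have e1 : t - -(1 - ‖x‖) = t - ‖x‖ + 1 := by ring
  have e2 : t - (1 + ‖x‖) = t - ‖x‖ - 1 := by ring
  rw [e1, e2]
  field_simp
  ring

/-- closed form inside, away from the origin -/
lemma aux_v_in (hf : Continuous f) (hF1 : ∀ s, HasDerivAt F1 (f s) s)
    (hF2 : ∀ s, HasDerivAt F2 (F1 s) s) (hF3 : ∀ s, HasDerivAt F3 (F2 s) s) (M : ℝ)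
    (hM : ∀ t, |f t| ≤ M) (t : ℝ) (x : EuclideanSpace ℝ (Fin 3)) (hx0 : x ≠ 0) (hx : ‖x‖ < 1) :
    (1 / (4 * π)) *
        ∫ y in closedBall (0 : EuclideanSpace ℝ (Fin 3)) 1, f (t - ‖x - y‖) / ‖x - y‖ =
      F2 t - (1 / 2) * ((F2 (t - 1 + ‖x‖) + F3 (t - 1 + ‖x‖)
        - (F2 (t - 1 - ‖x‖) + F3 (t - 1 - ‖x‖))) / ‖x‖) := by
  have hc : Continuous F1 := continuous_iff_continuousAt.2 fun s => (hF1 s).continuousAt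
  have hp := norm_pos_iff.2 hx0
  rw [aux_v hf hF1 M hM, aux_dist_in hc hF2 t _ hp.le hx,
    aux_outer hc hF2 hF3 t _ hp hx.ne, abs_of_nonneg (by linarith)]
  have e1 : t - (1 - ‖x‖) = t - 1 + ‖x‖ := by ring
  have e2 : t - (1 + ‖x‖) = t - 1 - ‖x‖ := by ring
  have e3 : t - ‖x‖ - 1 = t - 1 - ‖x‖ := by ring
  have e4 : t + ‖x‖ - 1 = t - 1 + ‖x‖ := by ring
  rw [e1, e2, e3, e4]
  field_simp
  ring

lemma aux_v_zero (hf : Continuous f) (hF1 : ∀ s, HasDerivAt F1 (f s) s)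
    (hF2 : ∀ s, HasDerivAt F2 (F1 s) s) (M : ℝ)
    (hM : ∀ t, |f t| ≤ M) (t : ℝ) :
    (1 / (4 * π)) *
        ∫ y in closedBall (0 : EuclideanSpace ℝ (Fin 3)) 1,
          f (t - ‖(0 : EuclideanSpace ℝ (Fin 3)) - y‖) / ‖(0 : EuclideanSpace ℝ (Fin 3)) - y‖ =
      F2 t - (F1 (t - 1) + F2 (t - 1)) := by
  have hc : Continuous F1 := continuous_iff_continuousAt.2 fun s => (hF1 s).continuousAt
  rw [aux_v hf hF1 M hM, norm_zero, aux_dist_in hc hF2 t 0 le_rfl one_pos]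
  simp
  ring

/-- closed form inside, as an integral -/
lemma aux_v_in' (hf : Continuous f) (hF1 : ∀ s, HasDerivAt F1 (f s) s)
    (hF2 : ∀ s, HasDerivAt F2 (F1 s) s) (hF3 : ∀ s, HasDerivAt F3 (F2 s) s) (M : ℝ)
    (hM : ∀ t, |f t| ≤ M) (t : ℝ) (i : Fin 3) (a : ℝ) (ha : |a| < 1) :
    (1 / (4 * π)) *
        ∫ y in closedBall (0 : EuclideanSpace ℝ (Fin 3)) 1,
          f (t - ‖a • EuclideanSpace.single i (1:ℝ) - y‖) /
            ‖a • EuclideanSpace.single i (1:ℝ) - y‖ =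
      F2 t - (1 / 2) * ∫ c in (-1:ℝ)..1, (F1 (t - 1 + a * c) + F2 (t - 1 + a * c)) := by
  have hc : Continuous F1 := continuous_iff_continuousAt.2 fun s => (hF1 s).continuousAt
  have hc2 : Continuous F2 := continuous_iff_continuousAt.2 fun s => (hF2 s).continuousAt
  have hn : ‖a • EuclideanSpace.single i (1:ℝ)‖ = |a| := by simp [norm_smul]
  by_cases h0 : a = 0
  · subst h0
    rw [zero_smul, aux_v_zero hf hF1 hF2 M hM]
    simp
    ring
  · rw [aux_v_in hf hF1 hF2 hF3 M hM t _ (by simp [h0]) (by rwa [hn]), hn]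
    rw [intervalIntegral.integral_comp_add_mul (fun s => F1 s + F2 s) h0,
      intervalIntegral.integral_eq_sub_of_hasDerivAt (fun s _ => (hF2 s).add (hF3 s))
        ((hc.add hc2).intervalIntegrable _ _)]
    simp only [Pi.add_apply, smul_eq_mul]
    rcases abs_choice a with h | h <;> rw [h] <;> field_simp <;> ring_nf

end closed

open Filter Topology in
lemma aux_radial (x : EuclideanSpace ℝ (Fin 3)) (hx : x ≠ 0) (u : EuclideanSpace ℝ (Fin 3) → ℝ)
    (ψ ψ' : ℝ → ℝ) (c : ℝ) (hu : ∀ᶠ y in 𝓝 x, u y = ψ ‖y‖)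
    (h1 : ∀ᶠ s in 𝓝 ‖x‖, HasDerivAt ψ (ψ' s) s) (h2 : HasDerivAt ψ' c ‖x‖) :
    (∀ i : Fin 3,
        DifferentiableAt ℝ (fun a : ℝ => u (x + a • EuclideanSpace.single i (1:ℝ))) 0 ∧
        DifferentiableAt ℝ
          (deriv fun a : ℝ => u (x + a • EuclideanSpace.single i (1:ℝ))) 0) ∧
    (∑ i : Fin 3, deriv (deriv fun a : ℝ => u (x + a • EuclideanSpace.single i (1:ℝ))) 0) =
      c + 2 * ψ' ‖x‖ / ‖x‖ := by
  have hr : 0 < ‖x‖ := norm_pos_iff.2 hx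
  have key : ∀ i : Fin 3,
      DifferentiableAt ℝ (fun a : ℝ => u (x + a • EuclideanSpace.single i (1:ℝ))) 0 ∧
      HasDerivAt (deriv fun a : ℝ => u (x + a • EuclideanSpace.single i (1:ℝ)))
        (c * (x i ^ 2 / ‖x‖ ^ 2) + ψ' ‖x‖ * (1 / ‖x‖ - x i ^ 2 / ‖x‖ ^ 3)) 0 := by
    intro i
    let N : ℝ → ℝ := fun a => ‖x + a • EuclideanSpace.single i (1:ℝ)‖
    have hN : N = fun a => √(‖x‖ ^ 2 + 2 * x i * a + a ^ 2) := by
      ext a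
      simp only [N]
      rw [← sqrt_sq (norm_nonneg (x + _)), norm_add_sq_real]
      congr 1
      simp [norm_smul, inner_smul_right, EuclideanSpace.inner_single_right]
      ring
    have hN0 : N 0 = ‖x‖ := by simp [N]
    have hcN : Continuous N := by simp only [N]; fun_prop
    have hNd : ∀ a, 0 < N a → HasDerivAt N ((x i + a) / N a) a := by
      intro a ha
      rw [hN] at ha
      simp only [sqrt_pos] at ha
      have h : HasDerivAt (fun a => ‖x‖ ^ 2 + 2 * x i * a + a ^ 2) (2 * x i + 2 * a) a := by
        have := (((hasDerivAt_id a).const_mul (2 * x i)).const_add (‖x‖ ^ 2)).add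
          (hasDerivAt_pow 2 a)
        refine this.congr_deriv ?_
        simp
      have h' := h.sqrt ha.ne'
      rw [← congrFun hN a, ← hN] at h'
      refine h'.congr_deriv ?_
      rw [← mul_add, mul_div_mul_left _ _ two_ne_zero]
    have hcont : Continuous fun a : ℝ => x + a • EuclideanSpace.single i (1:ℝ) := by fun_prop
    have ht1 : Tendsto (fun a : ℝ => x + a • EuclideanSpace.single i (1:ℝ)) (𝓝 0) (𝓝 x) := by
      have := hcont.tendsto 0
      simpa using this
    have ht2 : Tendsto N (𝓝 0) (𝓝 ‖x‖) := by
      have := hcN.tendsto 0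
      rwa [hN0] at this
    have hev : (fun a : ℝ => u (x + a • EuclideanSpace.single i (1:ℝ))) =ᶠ[𝓝 0]
        fun a => ψ (N a) := ht1.eventually hu
    have hpos : ∀ᶠ a in 𝓝 (0:ℝ), 0 < N a := ht2.eventually (lt_mem_nhds hr)
    have hdd : ∀ᶠ a in 𝓝 (0:ℝ), HasDerivAt (fun a => ψ (N a)) (ψ' (N a) * ((x i + a) / N a)) a := by
      filter_upwards [hpos, ht2.eventually h1] with a ha hψ
      exact hψ.comp a (hNd a ha)
    have hder : (deriv fun a : ℝ => u (x + a • EuclideanSpace.single i (1:ℝ))) =ᶠ[𝓝 0]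
        fun a => ψ' (N a) * ((x i + a) / N a) := by
      filter_upwards [hev.eventually_nhds, hdd] with a ha hd
      exact (hd.congr_of_eventuallyEq ha).deriv
    refine ⟨(hdd.self_of_nhds.congr_of_eventuallyEq hev).differentiableAt, ?_⟩
    have hN' := hNd 0 (hN0 ▸ hr)
    have hψ2 : HasDerivAt (fun a => ψ' (N a)) (c * ((x i + 0) / N 0)) 0 := by
      have h2' : HasDerivAt ψ' c (N 0) := by rwa [hN0]
      exact h2'.comp 0 hN'
    have hfin := hψ2.mul (((hasDerivAt_id (0:ℝ)).const_add (x i)).div hN' (by rw [hN0]; exact hr.ne'))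
    refine (hfin.congr_of_eventuallyEq hder).congr_deriv ?_
    simp only [hN0, id, add_zero, Pi.div_apply]
    field_simp
  refine ⟨fun i => ⟨(key i).1, (key i).2.differentiableAt⟩, ?_⟩
  simp_rw [fun i => (key i).2.deriv]
  have hs : ‖x‖ ^ 2 = x 0 ^ 2 + x 1 ^ 2 + x 2 ^ 2 := by
    rw [EuclideanSpace.norm_sq_eq, Fin.sum_univ_three]
    simp
  rw [Fin.sum_univ_three]
  have h3 : x 2 ^ 2 = ‖x‖ ^ 2 - x 0 ^ 2 - x 1 ^ 2 := by linarith
  rw [h3]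
  field_simp
  ring

open Filter Topology in
lemma aux_param (k k' : ℝ → ℝ) (hk : ∀ s, HasDerivAt k (k' s) s) (hk' : Continuous k')
    (τ a : ℝ) (n : ℕ) :
    HasDerivAt (fun a => ∫ c in (-1:ℝ)..1, c ^ n * k (τ + a * c))
      (∫ c in (-1:ℝ)..1, c ^ (n + 1) * k' (τ + a * c)) a := by
  have hc : Continuous k := continuous_iff_continuousAt.2 fun s => (hk s).continuousAt
  obtain ⟨C, hC⟩ := (isCompact_Icc (a := τ - (|a| + 1)) (b := τ + (|a| + 1))).exists_bound_of_continuousOn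
    hk'.continuousOn
  refine (intervalIntegral.hasDerivAt_integral_of_dominated_loc_of_deriv_le
    (F := fun a c => c ^ n * k (τ + a * c)) (F' := fun a c => c ^ (n + 1) * k' (τ + a * c))
    (bound := fun _ => C)
    (ball_mem_nhds a one_pos) ?_ ?_ ?_ ?_ ?_ ?_).2
  · exact Eventually.of_forall fun b => Continuous.aestronglyMeasurable (by fun_prop)
  · exact Continuous.intervalIntegrable (by fun_prop) _ _
  · exact Continuous.aestronglyMeasurable (by fun_prop)
  · refine Eventually.of_forall fun c hc b hb => ?_
    rw [uIoc_of_le (by norm_num)] at hc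
    have hc1 : |c| ≤ 1 := abs_le.2 ⟨hc.1.le, hc.2⟩
    have hb1 : |b| ≤ |a| + 1 := by
      rw [mem_ball, Real.dist_eq] at hb
      have := abs_sub_abs_le_abs_sub b a
      linarith
    have hbc : |b * c| ≤ |a| + 1 := by
      rw [abs_mul]
      nlinarith [abs_nonneg b, abs_nonneg c]
    have h1 := hC (τ + b * c) ⟨by linarith [neg_le_of_abs_le hbc], by linarith [le_of_abs_le hbc]⟩
    rw [norm_mul, norm_pow, Real.norm_eq_abs c]
    have h2 : |c| ^ (n + 1) ≤ 1 := pow_le_one₀ (abs_nonneg _) hc1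
    calc _ ≤ 1 * ‖k' (τ + b * c)‖ := by gcongr
      _ ≤ C := by rwa [one_mul]
  · exact intervalIntegrable_const
  · refine Eventually.of_forall fun c _ b _ => ?_
    have h1 : HasDerivAt (fun b => τ + b * c) c b := by
      simpa using ((hasDerivAt_id b).mul_const c).const_add τ
    refine (((hk _).comp b h1).const_mul (c ^ n)).congr_deriv ?_
    ring

lemma aux_shiftl {g g' : ℝ → ℝ} (h : ∀ s, HasDerivAt g (g' s) s) (t s : ℝ) :
    HasDerivAt (fun s => g (t + s)) (g' (t + s)) s := by
  have := (h (t + s)).comp s ((hasDerivAt_id s).const_add t)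
  refine this.congr_deriv ?_
  simp

lemma aux_shiftr {g g' : ℝ → ℝ} (h : ∀ s, HasDerivAt g (g' s) s) (t s : ℝ) :
    HasDerivAt (fun s => g (s + t)) (g' (s + t)) s := by
  simpa [add_comm] using aux_shiftl h t s

lemma aux_twice (g g1 g2 : ℝ → ℝ) (h1 : ∀ s, HasDerivAt g (g1 s) s)
    (h2 : ∀ s, HasDerivAt g1 (g2 s) s) (t : ℝ) :
    (DifferentiableAt ℝ g t ∧ DifferentiableAt ℝ (deriv g) t) ∧ deriv (deriv g) t = g2 t := by
  have : deriv g = g1 := funext fun s => (h1 s).deriv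
  rw [this]
  exact ⟨⟨(h1 t).differentiableAt, (h2 t).differentiableAt⟩, (h2 t).deriv⟩

/-- derivatives of an (outgoing or incoming) spherical wave profile -/
lemma aux_sph (U0 U1 : ℝ → ℝ) (h : ∀ s, HasDerivAt U0 (U1 s) s) (n : ℕ) (s : ℝ) (hs : s ≠ 0) :
    HasDerivAt (fun s => U0 s / s ^ n) (U1 s / s ^ n - n * U0 s / s ^ (n + 1)) s := by
  refine ((h s).div (hasDerivAt_pow n s) (pow_ne_zero _ hs)).congr_deriv ?_
  rcases n with _ | n
  · simp
  · simp only [Nat.add_sub_cancel]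
    field_simp
    ring

lemma aux_sph1 (U0 U1 : ℝ → ℝ) (h : ∀ s, HasDerivAt U0 (U1 s) s) (s : ℝ) (hs : s ≠ 0) :
    HasDerivAt (fun s => U0 s / s) (U1 s / s - U0 s / s ^ 2) s := by
  simpa using aux_sph U0 U1 h 1 s hs

lemma aux_sph2 (U0 U1 U2 : ℝ → ℝ) (h : ∀ s, HasDerivAt U0 (U1 s) s)
    (h' : ∀ s, HasDerivAt U1 (U2 s) s) (s : ℝ) (hs : s ≠ 0) :
    HasDerivAt (fun s => U1 s / s - U0 s / s ^ 2)
      (U2 s / s - 2 * (U1 s / s - U0 s / s ^ 2) / s) s := by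
  refine ((aux_sph1 U1 U2 h' s hs).sub (aux_sph U0 U1 h 2 s hs)).congr_deriv ?_
  push_cast
  field_simp
  ring

/-- derivatives of second order for `A + U(‖x‖)/‖x‖` -/
lemma aux_lap_sph (x : EuclideanSpace ℝ (Fin 3)) (hx : x ≠ 0) (u : EuclideanSpace ℝ (Fin 3) → ℝ)
    (A : ℝ) (U0 U1 U2 : ℝ → ℝ) (h : ∀ s, HasDerivAt U0 (U1 s) s)
    (h' : ∀ s, HasDerivAt U1 (U2 s) s)
    (hu : ∀ᶠ y in nhds x, u y = A + U0 ‖y‖ / ‖y‖) :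
    (∀ i : Fin 3,
        DifferentiableAt ℝ (fun a : ℝ => u (x + a • EuclideanSpace.single i (1:ℝ))) 0 ∧
        DifferentiableAt ℝ
          (deriv fun a : ℝ => u (x + a • EuclideanSpace.single i (1:ℝ))) 0) ∧
    (∑ i : Fin 3, deriv (deriv fun a : ℝ => u (x + a • EuclideanSpace.single i (1:ℝ))) 0) =
      U2 ‖x‖ / ‖x‖ := by
  have hr : 0 < ‖x‖ := norm_pos_iff.2 hx
  have := aux_radial x hx u (fun s => A + U0 s / s) (fun s => U1 s / s - U0 s / s ^ 2) _ hu ?_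
    (aux_sph2 U0 U1 U2 h h' ‖x‖ hr.ne')
  · refine ⟨this.1, ?_⟩
    rw [this.2]
    ring
  · filter_upwards [lt_mem_nhds hr] with s hs
    exact (aux_sph1 U0 U1 h s hs.ne').const_add A

lemma aux_antider (g : ℝ → ℝ) (hg : Continuous g) :
    ∃ G : ℝ → ℝ, (∀ s, HasDerivAt G (g s) s) ∧ Continuous G := by
  have h : ∀ s, HasDerivAt (fun t => ∫ u in (0:ℝ)..t, g u) (g s) s := fun s =>
    intervalIntegral.integral_hasDerivAt_right (hg.intervalIntegrable _ _)
      (hg.stronglyMeasurableAtFilter _ _) hg.continuousAt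
  exact ⟨_, h, continuous_iff_continuousAt.2 fun s => (h s).continuousAt⟩

/-- **The retarded potential of the source `f(t)·𝟙_{‖y‖≤1}(y)` solves the
inhomogeneous wave equation** `v_tt − Δv = f(t)·𝟙_{‖x‖<1}(x)` at every point off
the unit sphere. Here `v(x,t) = (1/(4π))∫_{‖y‖≤1} f(t−‖x−y‖)/‖x−y‖ dy`, and the
Laplacian is the sum of the three second partial derivatives in `x`. -/
theorem retarded_potential_solves_wave_equation
    (f : ℝ → ℝ) (hf : ContDiff ℝ 2 f)
    (hb : ∃ M : ℝ, ∀ t, |f t| ≤ M ∧ |deriv f t| ≤ M ∧ |deriv (deriv f) t| ≤ M)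
    (v : EuclideanSpace ℝ (Fin 3) → ℝ → ℝ)
    (hv : ∀ x t, v x t =
      (1 / (4 * π)) *
        ∫ y in closedBall (0 : EuclideanSpace ℝ (Fin 3)) 1, f (t - ‖x - y‖) / ‖x - y‖) :
    ∀ (t : ℝ) (x : EuclideanSpace ℝ (Fin 3)), ‖x‖ ≠ 1 →
      -- v is twice differentiable in t at (x, t)
      (DifferentiableAt ℝ (fun t' => v x t') t ∧
        DifferentiableAt ℝ (deriv fun t' => v x t') t) ∧
      -- v is twice differentiable in each spatial direction at (x, t)
      (∀ i : Fin 3,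
        DifferentiableAt ℝ (fun a : ℝ => v (x + a • EuclideanSpace.single i (1:ℝ)) t) 0 ∧
        DifferentiableAt ℝ
          (deriv fun a : ℝ => v (x + a • EuclideanSpace.single i (1:ℝ)) t) 0) ∧
      -- the wave equation v_tt − Δv = f(t)·𝟙_{‖x‖<1}(x)
      deriv (deriv fun t' => v x t') t -
        (∑ i : Fin 3,
          deriv (deriv fun a : ℝ => v (x + a • EuclideanSpace.single i (1:ℝ)) t) 0) =
      f t * indicator (ball (0 : EuclideanSpace ℝ (Fin 3)) 1) (fun _ => (1:ℝ)) x := by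
  intro t x hx
  obtain ⟨M, hM'⟩ := hb
  have hM : ∀ t, |f t| ≤ M := fun t => (hM' t).1
  have hfc : Continuous f := hf.continuous
  have hfd : ∀ s, HasDerivAt f (deriv f s) s := fun s =>
    (hf.differentiable (by norm_num) s).hasDerivAt
  have hf'c : Continuous (deriv f) := hf.continuous_deriv (by norm_num)
  obtain ⟨F1, hF1, hc1⟩ := aux_antider f hfc
  obtain ⟨F2, hF2, hc2⟩ := aux_antider F1 hc1
  obtain ⟨F3, hF3, hc3⟩ := aux_antider F2 hc2
  rcases lt_or_gt_of_ne hx with hlt | hgt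
  · have hind : indicator (ball (0 : EuclideanSpace ℝ (Fin 3)) 1) (fun _ => (1:ℝ)) x = 1 := by
      simp [hlt]
    rw [hind, mul_one]
    let W0 : ℝ → ℝ := fun s => F2 s + F3 s
    let W1 : ℝ → ℝ := fun s => F1 s + F2 s
    let W2 : ℝ → ℝ := fun s => f s + F1 s
    let W3 : ℝ → ℝ := fun s => deriv f s + f s
    have hW0 : ∀ s, HasDerivAt W0 (W1 s) s := fun s => (hF2 s).add (hF3 s)
    have hW1 : ∀ s, HasDerivAt W1 (W2 s) s := fun s => (hF1 s).add (hF2 s)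
    have hW2 : ∀ s, HasDerivAt W2 (W3 s) s := fun s => (hfd s).add (hF1 s)
    have hW2c : Continuous W2 := hfc.add hc1
    have hW3c : Continuous W3 := hf'c.add hfc
    by_cases hx0 : x = 0
    · subst hx0
      have hvt : (fun t' => v 0 t') = fun t' => F2 t' - W1 (t' + (-1)) := by
        ext t'
        rw [hv, aux_v_zero hfc hF1 hF2 M hM]
        rfl
      obtain ⟨hd, he⟩ := aux_twice (fun t' => F2 t' - W1 (t' + (-1)))
        (fun t' => F1 t' - W2 (t' + (-1))) (fun t' => f t' - W3 (t' + (-1)))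
        (fun s => (hF2 s).sub (aux_shiftr hW1 _ s)) (fun s => (hF1 s).sub (aux_shiftr hW2 _ s)) t
      rw [hvt]
      refine ⟨hd, ?_⟩
      rw [he]
      have key : ∀ i : Fin 3,
          DifferentiableAt ℝ (fun a : ℝ => v (0 + a • EuclideanSpace.single i (1:ℝ)) t) 0 ∧
          HasDerivAt (deriv fun a : ℝ => v (0 + a • EuclideanSpace.single i (1:ℝ)) t)
            (- (1 / 3) * W3 (t - 1)) 0 := by
        intro i
        have hev : (fun a : ℝ => v (0 + a • EuclideanSpace.single i (1:ℝ)) t) =ᶠ[nhds 0]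
            fun a => F2 t - (1 / 2) * ∫ c in (-1:ℝ)..1, c ^ 0 * W1 (t - 1 + a * c) := by
          filter_upwards [ball_mem_nhds (0:ℝ) one_pos] with a ha
          rw [hv, zero_add, aux_v_in' hfc hF1 hF2 hF3 M hM t i a (by simpa using ha)]
          simp [W1]
        have h1 : ∀ a, HasDerivAt
            (fun a => F2 t - (1 / 2) * ∫ c in (-1:ℝ)..1, c ^ 0 * W1 (t - 1 + a * c))
            (- ((1 / 2) * ∫ c in (-1:ℝ)..1, c ^ (0 + 1) * W2 (t - 1 + a * c))) a := fun a =>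
          ((aux_param W1 W2 hW1 hW2c (t - 1) a 0).const_mul (1 / 2)).const_sub _
        have h2 := ((aux_param W2 W3 hW2 hW3c (t - 1) 0 (0 + 1)).const_mul (1 / 2)).neg
        have hder : (deriv fun a : ℝ => v (0 + a • EuclideanSpace.single i (1:ℝ)) t) =ᶠ[nhds 0]
            fun a => - ((1 / 2) * ∫ c in (-1:ℝ)..1, c ^ (0 + 1) * W2 (t - 1 + a * c)) := by
          filter_upwards [hev.eventually_nhds] with a ha
          exact ((h1 a).congr_of_eventuallyEq ha).deriv
        refine ⟨((h1 0).congr_of_eventuallyEq hev).differentiableAt, ?_⟩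
        refine (h2.congr_of_eventuallyEq hder).congr_deriv ?_
        simp only [zero_mul, add_zero, zero_add, intervalIntegral.integral_mul_const]
        norm_num [integral_pow]
        ring
      refine ⟨fun i => ⟨(key i).1, (key i).2.differentiableAt⟩, ?_⟩
      simp_rw [fun i => (key i).2.deriv]
      rw [← sub_eq_add_neg]
      simp
    · have hr : 0 < ‖x‖ := norm_pos_iff.2 hx0
      have hvt : (fun t' => v x t') = fun t' => F2 t' - (1 / 2) *
          ((W0 (t' + (-1 + ‖x‖)) - W0 (t' + (-1 - ‖x‖))) / ‖x‖) := by
        ext t'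
        rw [hv, aux_v_in hfc hF1 hF2 hF3 M hM t' x hx0 hlt]
        simp only [W0]
        ring_nf
      obtain ⟨hd, he⟩ := aux_twice _ _ _
        (fun s => (hF2 s).sub ((((aux_shiftr hW0 (-1 + ‖x‖) s).sub
          (aux_shiftr hW0 (-1 - ‖x‖) s)).div_const ‖x‖).const_mul (1 / 2)))
        (fun s => (hF1 s).sub ((((aux_shiftr hW1 (-1 + ‖x‖) s).sub
          (aux_shiftr hW1 (-1 - ‖x‖) s)).div_const ‖x‖).const_mul (1 / 2))) t
      have hsp := aux_lap_sph x hx0 (fun y => v y t) (F2 t)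
        (fun s => - (1 / 2) * (W0 (t - 1 + s) - W0 (t - 1 - s)))
        (fun s => - (1 / 2) * (W1 (t - 1 + s) - - W1 (t - 1 - s)))
        (fun s => - (1 / 2) * (W2 (t - 1 + s) - - - W2 (t - 1 - s)))
        (fun s => ((aux_shiftl hW0 (t - 1) s).sub (aux_shift hW0 (t - 1) s)).const_mul _)
        (fun s => ((aux_shiftl hW1 (t - 1) s).sub (aux_shift hW1 (t - 1) s).neg).const_mul _)
        (by
          have e1 : ∀ᶠ y in nhds x, ‖y‖ < 1 := continuous_norm.continuousAt.eventually
            (gt_mem_nhds hlt)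
          have e2 : ∀ᶠ y in nhds x, 0 < ‖y‖ := continuous_norm.continuousAt.eventually
            (lt_mem_nhds hr)
          filter_upwards [e1, e2] with y h1 h2
          rw [hv, aux_v_in hfc hF1 hF2 hF3 M hM t y (norm_pos_iff.1 h2) h1]
          simp only [W0]
          ring)
      rw [hvt]
      refine ⟨hd, hsp.1, ?_⟩
      rw [hsp.2]
      refine (congrArg (· - _) he).trans ?_
      have e1 : t + (-1 + ‖x‖) = t - 1 + ‖x‖ := by ring
      have e2 : t + (-1 - ‖x‖) = t - 1 - ‖x‖ := by ring
      simp only [e1, e2]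
      ring
  · have hind : indicator (ball (0 : EuclideanSpace ℝ (Fin 3)) 1) (fun _ => (1:ℝ)) x = 0 := by
      simp [hgt.le]
    rw [hind, mul_zero]
    have hr : 0 < ‖x‖ := by linarith
    have hx0 : x ≠ 0 := norm_pos_iff.1 hr
    let U0 : ℝ → ℝ := fun s => F2 (s + (-1)) + F3 (s + (-1)) + F2 (s + 1) - F3 (s + 1)
    let U1 : ℝ → ℝ := fun s => F1 (s + (-1)) + F2 (s + (-1)) + F1 (s + 1) - F2 (s + 1)
    let U2 : ℝ → ℝ := fun s => f (s + (-1)) + F1 (s + (-1)) + f (s + 1) - F1 (s + 1)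
    have hU0 : ∀ s, HasDerivAt U0 (U1 s) s := fun s =>
      (((aux_shiftr hF2 _ s).add (aux_shiftr hF3 _ s)).add (aux_shiftr hF2 _ s)).sub
        (aux_shiftr hF3 _ s)
    have hU1 : ∀ s, HasDerivAt U1 (U2 s) s := fun s =>
      (((aux_shiftr hF1 _ s).add (aux_shiftr hF2 _ s)).add (aux_shiftr hF1 _ s)).sub
        (aux_shiftr hF2 _ s)
    have hvt : (fun t' => v x t') = fun t' => (1 / 2) * (U0 (t' + (- ‖x‖)) / ‖x‖) := by
      ext t'
      rw [hv, aux_v_out hfc hF1 hF2 hF3 M hM t' x hgt]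
      simp only [U0, sub_eq_add_neg]
    obtain ⟨hd, he⟩ := aux_twice _ _ _
      (fun s => ((aux_shiftr hU0 (- ‖x‖) s).div_const ‖x‖).const_mul (1 / 2))
      (fun s => ((aux_shiftr hU1 (- ‖x‖) s).div_const ‖x‖).const_mul (1 / 2)) t
    have hsp := aux_lap_sph x hx0 (fun y => v y t) 0
      (fun s => (1 / 2) * U0 (t - s))
      (fun s => (1 / 2) * - U1 (t - s))
      (fun s => (1 / 2) * - - U2 (t - s))
      (fun s => (aux_shift hU0 t s).const_mul _)
      (fun s => (aux_shift hU1 t s).neg.const_mul _)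
      (by
        have e1 : ∀ᶠ y in nhds x, 1 < ‖y‖ := continuous_norm.continuousAt.eventually
          (lt_mem_nhds hgt)
        filter_upwards [e1] with y h1
        rw [hv, aux_v_out hfc hF1 hF2 hF3 M hM t y h1]
        simp only [U0, sub_eq_add_neg]
        ring)
    rw [hvt]
    refine ⟨hd, hsp.1, ?_⟩
    rw [hsp.2]
    refine (congrArg (· - _) he).trans ?_
    simp only [← sub_eq_add_neg]
    ring
end
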